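/- For all n ≥ 1 and 1 ≤ d ≤ n, Σ_{A_1 A_2 ... A_k ∈ Y_{n,d}} (-1)^{n-k} = |T_{n,d}|, where the sum ranges over all Fishburn diagrams with n dots and d(A) = d (k being the number of columns). -/

import Mathlib

/-- The Fishburn diagrams with `k` columns: sequences of sets `A_1 … A_k` (indexed
0-based by `Fin k`) with each `A_i` a nonempty subset of `{0, 1, …, i-1}`
(0-based: `A i ⊆ {0, …, i}`). -/
def fishburnDiagrams (k : ℕ) : Finset (Fin k → Finset ℕ) :=
  Fintype.piFinset fun i => ((Finset.range (i.1 + 1)).powerset.erase ∅)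

/-- The number of dots of a Fishburn diagram. -/
def dots {k : ℕ} (A : Fin k → Finset ℕ) : ℕ := ∑ i, (A i).card

/-- The statistic `d(A)`: the number of columns `i` (1-based) with `i - 1 ∈ A_i`,
i.e. 0-based the number of `i` with `i ∈ A i`. -/
def dstat {k : ℕ} (A : Fin k → Finset ℕ) : ℕ :=
  (Finset.univ.filter (fun i : Fin k => i.1 ∈ A i)).card

namespace FishburnDiagram

/-! ### Partially filled inversion tables

A partially filled table is a list of naturals: `0` stands for an entry not yet chosen and `j + 1`
for the value `j`. -/

/-- The lists obtained from `g` by raising all chosen values by one and then choosing the smallest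
value at some of the open places preceding the first old occurrence of the smallest value. -/
def extensions : List ℕ → Finset (List ℕ)
  | [] => {[]}
  | 0 :: g => (extensions g).image (List.cons 0) ∪ (extensions g).image (List.cons 1)
  | 1 :: g => {2 :: g.map fun a => if a = 0 then 0 else a + 1}
  | (k + 2) :: g => (extensions g).image (List.cons (k + 3))

/-- The partially filled tables of length `m`. -/
def tables : ℕ → Finset (List ℕ)
  | 0 => {[]}
  | m + 1 => (tables m).biUnion fun g =>
      (extensions g).image (List.cons 0) ∪ (extensions g).image (List.cons 1)

/-- The number of entries on the diagonal, when the first diagonal value is `k`. -/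
def diagCount : ℕ → List ℕ → ℕ
  | _, [] => 0
  | k, a :: g => (if a = k then 1 else 0) + diagCount (k + 1) g

/-- The bound of an inversion table whose first entry is at most `k`. -/
def Bounded : ℕ → List ℕ → Prop
  | _, [] => True
  | k, a :: g => a ≤ k ∧ Bounded (k + 1) g

/-- Every later entry of `g` is open or differs from the predecessor of each earlier entry. -/
def Admissible (g : List ℕ) : Prop :=
  g.Pairwise fun a b => b = 0 ∨ a ≠ b + 1

theorem mem_extensions {g h : List ℕ} :
    h ∈ extensions g ↔
      h.map (· - 1) = g ∧ h.Pairwise (fun a b => ¬ (a = 2 ∧ b = 1)) := by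
  induction g generalizing h with
  | nil => simp only [extensions, Finset.mem_singleton, List.map_eq_nil_iff]
           constructor
           · rintro rfl; simp
           · exact fun h => h.1
  | cons c g ih =>
    match c with
    | 0 =>
      simp only [extensions, Finset.mem_union, Finset.mem_image, ih]
      constructor
      · rintro (⟨h, ⟨h1, h2⟩, rfl⟩ | ⟨h, ⟨h1, h2⟩, rfl⟩) <;>
          simp [h1, -not_and, h2]
      · rintro ⟨h1, h2⟩
        match h, h1, h2 with
        | a :: h, h1, h2 =>
          simp only [List.map_cons, List.cons.injEq] at h1
          rw [List.pairwise_cons] at h2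
          obtain rfl | rfl : a = 0 ∨ a = 1 := by omega
          · exact Or.inl ⟨h, ⟨h1.2, h2.2⟩, rfl⟩
          · exact Or.inr ⟨h, ⟨h1.2, h2.2⟩, rfl⟩
    | 1 =>
      simp only [extensions, Finset.mem_singleton]
      constructor
      · rintro rfl
        refine ⟨?_, ?_⟩
        · rw [List.map_cons, List.map_map]
          congr 1
          conv_rhs => rw [← List.map_id g]
          apply List.map_congr_left
          intro a _
          simp only [Function.comp, id]
          split_ifs <;> omega
        · have key : ∀ b ∈ g.map (fun a => if a = 0 then 0 else a + 1), b ≠ 1 := by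
            intro b hb
            obtain ⟨a, _, rfl⟩ := List.mem_map.1 hb
            split_ifs <;> omega
          rw [List.pairwise_cons]
          refine ⟨fun b hb hh => key b hb hh.2, ?_⟩
          exact List.Pairwise.imp_of_mem (R := fun _ _ => True)
            (fun _ hb _ hh => key _ hb hh.2) (List.pairwise_of_forall fun _ _ => trivial)
      · rintro ⟨h1, h2⟩
        match h, h1, h2 with
        | a :: h, h1, h2 =>
          simp only [List.map_cons, List.cons.injEq] at h1
          rw [List.pairwise_cons] at h2
          obtain rfl : a = 2 := by omega
          congr 1
          rw [← h1.2, List.map_map]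
          conv_lhs => rw [← List.map_id h]
          apply List.map_congr_left
          intro b hb
          have := h2.1 b hb
          simp only [Function.comp, id]
          split_ifs <;> omega
    | k + 2 =>
      simp only [extensions, Finset.mem_image, ih]
      constructor
      · rintro ⟨h, ⟨h1, h2⟩, rfl⟩
        refine ⟨by simp [h1], ?_⟩
        rw [List.pairwise_cons]
        exact ⟨fun b _ hh => by omega, h2⟩
      · rintro ⟨h1, h2⟩
        match h, h1, h2 with
        | a :: h, h1, h2 =>
          simp only [List.map_cons, List.cons.injEq] at h1
          rw [List.pairwise_cons] at h2
          obtain rfl : a = k + 3 := by omega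
          exact ⟨h, ⟨h1.2, h2.2⟩, rfl⟩

theorem bounded_succ_iff {h : List ℕ} {k : ℕ} :
    Bounded (k + 1) h ↔ Bounded k (h.map (· - 1)) := by
  induction h generalizing k with
  | nil => simp [Bounded]
  | cons a h ih => simp only [List.map_cons, Bounded, ih]; rw [tsub_le_iff_right]

theorem admissible_iff {h : List ℕ} :
    Admissible h ↔ Admissible (h.map (· - 1)) ∧ h.Pairwise (fun a b => ¬ (a = 2 ∧ b = 1)) := by
  rw [Admissible, Admissible, List.pairwise_map, ← List.pairwise_and_iff]
  constructor <;> exact fun hh => hh.imp fun {a b} => by omega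

theorem mem_tables {m : ℕ} {g : List ℕ} :
    g ∈ tables m ↔ g.length = m ∧ Bounded 1 g ∧ Admissible g := by
  induction m generalizing g with
  | zero =>
    simp only [tables, Finset.mem_singleton, List.length_eq_zero_iff]
    constructor
    · rintro rfl; simp [Bounded, Admissible]
    · exact fun h => h.1
  | succ m ih =>
    have front : ∀ {c : ℕ} {h : List ℕ}, c ≤ 1 → (Admissible (c :: h) ↔ Admissible h) := by
      intro c h hc
      rw [Admissible, List.pairwise_cons]
      exact ⟨fun h => h.2, fun h => ⟨fun b _ => by omega, h⟩⟩
    simp only [tables, Finset.mem_biUnion, Finset.mem_union, Finset.mem_image, ih, mem_extensions]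
    constructor
    · rintro ⟨g, ⟨rfl, h2, h3⟩, ⟨h, ⟨rfl, h5⟩, rfl⟩ | ⟨h, ⟨rfl, h5⟩, rfl⟩⟩ <;>
      · refine ⟨by simp, ⟨by omega, bounded_succ_iff.2 h2⟩, ?_⟩
        rw [front (by omega), admissible_iff]
        exact ⟨h3, h5⟩
    · rintro ⟨h1, h2, h3⟩
      match g, h1, h2, h3 with
      | c :: h, h1, h2, h3 =>
        rw [front h2.1, admissible_iff] at h3
        refine ⟨h.map (· - 1), ⟨by simpa using h1, bounded_succ_iff.1 h2.2, h3.1⟩, ?_⟩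
        have hc := h2.1
        obtain rfl | rfl : c = 0 ∨ c = 1 := by omega
        · exact Or.inl ⟨h, ⟨rfl, h3.2⟩, rfl⟩
        · exact Or.inr ⟨h, ⟨rfl, h3.2⟩, rfl⟩

theorem diagCount_succ (k : ℕ) (h : List ℕ) :
    diagCount (k + 2) h = diagCount (k + 1) (h.map (· - 1)) := by
  induction h generalizing k with
  | nil => rfl
  | cons a h ih =>
    simp only [List.map_cons, diagCount, ih (k + 1)]
    congr 1
    split_ifs <;> omega

section Weight

variable {R : Type*} [CommRing R]

/-- The weight of a partially filled table: open places before the first `1` have weight `z`, all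
others weight `y`. -/
def weight (y z : R) : List ℕ → R
  | [] => 1
  | 0 :: g => z * weight y z g
  | 1 :: g => weight y y g
  | (_ + 2) :: g => weight y z g

theorem weight_map_lift (y z : R) (g : List ℕ) :
    weight y z (g.map fun a => if a = 0 then 0 else a + 1) = weight z z g := by
  induction g with
  | nil => rfl
  | cons a g ih =>
    match a with
    | 0 => simpa [weight] using congrArg (z * ·) ih
    | 1 => simpa [weight] using ih
    | k + 2 => simpa [weight] using ih

theorem sum_image_cons (s : Finset (List ℕ)) (c : ℕ) (f : List ℕ → R) :
    ∑ h ∈ s.image (List.cons c), f h = ∑ h ∈ s, f (c :: h) :=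
  Finset.sum_image fun _ _ _ _ h => (List.cons.inj h).2

theorem sum_image_zero_union_image_one (s : Finset (List ℕ)) (f : List ℕ → R) :
    ∑ h ∈ s.image (List.cons 0) ∪ s.image (List.cons 1), f h =
      ∑ h ∈ s, f (0 :: h) + ∑ h ∈ s, f (1 :: h) := by
  rw [Finset.sum_union, sum_image_cons, sum_image_cons]
  rw [Finset.disjoint_left]
  intro h h0 h1
  obtain ⟨_, _, rfl⟩ := Finset.mem_image.1 h0
  obtain ⟨_, _, h2⟩ := Finset.mem_image.1 h1
  simp at h2

theorem sum_extensions_weight_self (y : R) (g : List ℕ) :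
    ∑ h ∈ extensions g, weight y y h = weight y (1 + y) g := by
  induction g with
  | nil => simp [extensions, weight]
  | cons a g ih =>
    match a with
    | 0 =>
      simp only [extensions, sum_image_zero_union_image_one, weight, ← Finset.mul_sum, ih]
      ring
    | 1 => simp [extensions, weight, weight_map_lift]
    | k + 2 => simp only [extensions, sum_image_cons, weight, ih]

theorem sum_extensions_weight (y z : R) (g : List ℕ) :
    (1 + y - z) * (∑ h ∈ extensions g, weight y z h - weight z z g) =
      weight y (1 + y) g - weight y z g := by
  induction g with
  | nil => simp [extensions, weight]
  | cons a g ih =>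
    match a with
    | 0 =>
      simp only [extensions, sum_image_zero_union_image_one, weight, ← Finset.mul_sum,
        sum_extensions_weight_self]
      linear_combination z * ih
    | 1 => simp [extensions, weight, weight_map_lift]
    | k + 2 => simpa only [extensions, sum_image_cons, weight] using ih

/-- The total weight of the partially filled tables of length `m`. -/
def tableSum (t y z : R) (m : ℕ) : R :=
  ∑ g ∈ tables m, t ^ diagCount 1 g * weight y z g

/-- The total weight of the extensions of the partially filled tables of length `m`. -/
def extensionSum (t y z : R) (m : ℕ) : R :=
  ∑ g ∈ tables m, t ^ diagCount 1 g * ∑ h ∈ extensions g, weight y z h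

theorem tableSum_succ (t y z : R) (m : ℕ) :
    tableSum t y z (m + 1) = z * extensionSum t y z m + t * tableSum t y (1 + y) m := by
  rw [tableSum, tables, Finset.sum_biUnion]
  · rw [extensionSum, tableSum, Finset.mul_sum, Finset.mul_sum, ← Finset.sum_add_distrib]
    refine Finset.sum_congr rfl fun g _ => ?_
    have hd : ∀ h ∈ extensions g, diagCount 2 h = diagCount 1 g := fun h hh => by
      rw [diagCount_succ, (mem_extensions.1 hh).1]
    rw [sum_image_zero_union_image_one, ← sum_extensions_weight_self]
    simp only [Finset.mul_sum]
    congr 1 <;> refine Finset.sum_congr rfl fun h hh => ?_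
    · simp only [diagCount, weight, hd h hh]
      simp; ring
    · simp only [diagCount, weight, hd h hh]
      simp [pow_add]; ring
  · intro g _ g' _ hne
    rw [Function.onFun, Finset.disjoint_left]
    intro l hl hl'
    simp only [Finset.mem_union, Finset.mem_image] at hl hl'
    apply hne
    have key : ∀ {g : List ℕ}, ((∃ a ∈ extensions g, 0 :: a = l) ∨ ∃ a ∈ extensions g, 1 :: a = l) →
        l.tail.map (· - 1) = g := by
      rintro g (⟨a, ha, rfl⟩ | ⟨a, ha, rfl⟩) <;> exact (mem_extensions.1 ha).1
    rw [← key hl, ← key hl']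

theorem extensionSum_relation (t y z : R) (m : ℕ) :
    (1 + y - z) * (extensionSum t y z m - tableSum t z z m) =
      tableSum t y (1 + y) m - tableSum t y z m := by
  simp only [extensionSum, tableSum, ← Finset.sum_sub_distrib, Finset.mul_sum]
  refine Finset.sum_congr rfl fun g _ => ?_
  have := sum_extensions_weight y z g
  rw [← Finset.mul_sum]
  linear_combination t ^ diagCount 1 g * this

end Weight

section Nilpotent

variable {R : Type*} [CommRing R] {x : R} {N : ℕ}

/-- The generating function in `x`, up to `x ^ N`, of the partially filled tables. -/
def tableSeries (x : R) (N : ℕ) (t y z : R) : R :=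
  ∑ m ∈ Finset.range N, x ^ m * tableSum t y z m

theorem tableSeries_relations (hx : x ^ N = 0) (t y z : R) :
    ∃ s : R, tableSeries x N t y z = 1 + x * (z * s + t * tableSeries x N t y (1 + y)) ∧
      (1 + y - z) * (s - tableSeries x N t z z) =
        tableSeries x N t y (1 + y) - tableSeries x N t y z := by
  refine ⟨∑ m ∈ Finset.range N, x ^ m * extensionSum t y z m, ?_, ?_⟩
  · have h1 : tableSeries x N t y z = ∑ m ∈ Finset.range (N + 1), x ^ m * tableSum t y z m := by
      rw [Finset.sum_range_succ, hx, zero_mul, add_zero, tableSeries]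
    rw [h1, Finset.sum_range_succ', tableSeries]
    simp only [tableSum_succ, Finset.mul_sum, ← Finset.sum_add_distrib]
    rw [add_comm]
    congr 1
    · simp [tableSum, tables, diagCount, weight]
    · exact Finset.sum_congr rfl fun m _ => by ring
  · simp only [tableSeries, ← Finset.sum_sub_distrib, Finset.mul_sum]
    refine Finset.sum_congr rfl fun m _ => ?_
    linear_combination x ^ m * extensionSum_relation t y z m

theorem tableSeries_self (hx : x ^ N = 0) (t y : R) :
    tableSeries x N t y y = 1 + x * (t + y) * tableSeries x N t y (1 + y) := by
  obtain ⟨s, h1, h2⟩ := tableSeries_relations hx t y y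
  linear_combination h1 + x * y * h2

theorem tableSeries_kernel (hx : x ^ N = 0) (t y z : R) (hz : (1 - x) * z = 1 + y) :
    (1 - t * x) * tableSeries x N t y (1 + y) =
      1 + x * z + x * z * (x * (t + z)) * tableSeries x N t z (1 + z) := by
  obtain ⟨s, h1, h2⟩ := tableSeries_relations hx t y z
  have h3 := tableSeries_self hx t z
  rw [← hz] at h1 h2 ⊢
  linear_combination h1 - h2 + x * z * h3

theorem exists_one_sub_mul_eq_one (hx : x ^ N = 0) (t : R) : ∃ r : R, r * (1 - t * x) = 1 := by
  have h : IsNilpotent (t * x) := ⟨N, by rw [mul_pow, hx, mul_zero]⟩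
  obtain ⟨r, hr⟩ := h.isUnit_one_sub.exists_left_inv
  exact ⟨r, hr⟩

theorem tableSeries_contiguous (hx : x ^ N = 0) (t y : R) :
    tableSeries x N t y (1 + y) =
      1 + x * (1 + y + (1 - x) * t) * tableSeries x N (1 + t - t * x) y (1 + y) := by
  obtain ⟨q, hq⟩ := exists_one_sub_mul_eq_one hx 1
  obtain ⟨r, hr⟩ := exists_one_sub_mul_eq_one hx t
  rw [one_mul] at hq
  suffices h : ∀ (j : ℕ) (y : R), x ^ j ∣ tableSeries x N t y (1 + y) -
      (1 + x * (1 + y + (1 - x) * t) * tableSeries x N (1 + t - t * x) y (1 + y)) by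
    have := h N y
    rw [hx, zero_dvd_iff] at this
    exact sub_eq_zero.1 this
  intro j
  induction j with
  | zero => simp
  | succ j ih =>
    intro y
    have hz : (1 - x) * (q * (1 + y)) = 1 + y := by linear_combination (1 + y) * hq
    generalize q * (1 + y) = z at hz
    have h1 := tableSeries_kernel hx t y z hz
    have h2 := tableSeries_kernel hx (1 + t - t * x) y z hz
    obtain ⟨c, hc⟩ := ih z
    refine ⟨r * (z * (x * (t + z))) * c, ?_⟩
    generalize tableSeries x N t y (1 + y) = a at *
    generalize tableSeries x N (1 + t - t * x) y (1 + y) = b at *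
    generalize tableSeries x N t z (1 + z) = a' at *
    generalize tableSeries x N (1 + t - t * x) z (1 + z) = b' at *
    obtain rfl : y = (1 - x) * z - 1 := by linear_combination -hz
    have h3 : (1 - t * x) * (a - (1 + x * ((1 - x) * z + (1 - x) * t) * b)) =
        x * z * (x * (t + z)) * (a' - (1 + x * (1 + z + (1 - x) * t) * b')) := by
      linear_combination h1 - x * (t + z) * h2
    linear_combination r * h3 + r * x * z * (x * (t + z)) * hc -
      (a - (1 + x * ((1 - x) * z + (1 - x) * t) * b)) * hr

theorem tableSeries_zero_zero (hx : x ^ N = 0) (t : R) :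
    tableSeries x N t 0 0 = 1 + t * x * tableSeries x N (1 + t - t * x) 0 0 := by
  have h1 := tableSeries_self hx t 0
  have h2 := tableSeries_self hx (1 + t - t * x) 0
  have h3 := tableSeries_contiguous hx t 0
  linear_combination h1 - t * x * h2 + t * x * h3

theorem tableSeries_eq_sum_prod (hx : x ^ N = 0) (t : R) :
    tableSeries x N t 0 0 =
      ∑ k ∈ Finset.range N, ∏ i ∈ Finset.range k, (1 - (1 - t * x) * (1 - x) ^ i) := by
  suffices h : ∀ (K : ℕ) (t : R), x ^ K ∣ tableSeries x N t 0 0 -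
      ∑ k ∈ Finset.range K, ∏ i ∈ Finset.range k, (1 - (1 - t * x) * (1 - x) ^ i) by
    have := h N t
    rw [hx, zero_dvd_iff] at this
    exact sub_eq_zero.1 this
  intro K
  induction K with
  | zero => simp
  | succ K ih =>
    intro t
    obtain ⟨c, hc⟩ := ih (1 + t - t * x)
    refine ⟨t * c, ?_⟩
    rw [Finset.sum_range_succ']
    have h : ∀ k, ∏ i ∈ Finset.range (k + 1), (1 - (1 - t * x) * (1 - x) ^ i) =
        t * x * ∏ i ∈ Finset.range k, (1 - (1 - (1 + t - t * x) * x) * (1 - x) ^ i) := by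
      intro k
      rw [Finset.prod_range_succ', mul_comm]
      congr 1
      · ring
      · exact Finset.prod_congr rfl fun i _ => by ring
    simp only [h, ← Finset.mul_sum, Finset.prod_range_zero]
    linear_combination tableSeries_zero_zero hx t + t * x * hc

end Nilpotent

section Diagrams

variable {R : Type*} [CommRing R]

theorem prod_eq_sum_fishburnDiagrams (x t : R) (k : ℕ) :
    ∏ i ∈ Finset.range k, (1 - (1 - t * x) * (1 - x) ^ i) =
      ∑ A ∈ fishburnDiagrams k, (-1) ^ (k + dots A) * (x ^ dots A * t ^ dstat A) := by
  have column : ∀ i : ℕ, 1 - (1 - t * x) * (1 - x) ^ i =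
      ∑ S ∈ (Finset.range (i + 1)).powerset.erase ∅,
        (-1) * ((-1) ^ S.card * (x ^ S.card * t ^ (if i ∈ S then 1 else 0))) := by
    intro i
    have h1 : (1 - t * x) * (1 - x) ^ i =
        ∏ j ∈ Finset.range (i + 1), (1 + -((if i = j then t else 1) * x)) := by
      rw [Finset.prod_range_succ, mul_comm]
      congr 1
      · rw [Finset.prod_congr rfl (g := fun _ => 1 - x), Finset.prod_const, Finset.card_range]
        intro j hj
        rw [if_neg (Finset.mem_range.1 hj).ne']
        ring
      · simp [sub_eq_add_neg]
    have h2 : ∀ S : Finset ℕ, ∏ j ∈ S, -((if i = j then t else 1) * x) =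
        (-1) ^ S.card * (x ^ S.card * t ^ (if i ∈ S then 1 else 0)) := by
      intro S
      simp only [← neg_one_mul ((if _ then t else 1) * x), Finset.prod_mul_distrib,
        Finset.prod_const, Finset.prod_ite_eq]
      split_ifs <;> ring
    rw [h1, Finset.prod_one_add,
      ← Finset.add_sum_erase _ _ (Finset.empty_mem_powerset (Finset.range (i + 1))),
      ← Finset.mul_sum]
    simp only [h2]
    simp
  simp only [column]
  rw [Finset.prod_range, Finset.prod_univ_sum, fishburnDiagrams]
  refine Finset.sum_congr rfl fun A _ => ?_
  simp only [Finset.prod_mul_distrib, Finset.prod_pow_eq_pow_sum, Finset.prod_const,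
    Finset.card_univ, Fintype.card_fin, pow_add, dots, dstat, Finset.card_filter]
  ring

end Diagrams

section Words

theorem weight_zero_zero {R : Type*} [CommRing R] (g : List ℕ) :
    weight (0 : R) 0 g = if 0 ∈ g then 0 else 1 := by
  induction g with
  | nil => simp [weight]
  | cons a g ih =>
    match a with
    | 0 => simp [weight]
    | 1 => simp [weight, ih]
    | k + 2 => simp [weight, ih]

theorem bounded_ofFn {n : ℕ} (k : ℕ) (f : Fin n → ℕ) :
    Bounded k (List.ofFn f) ↔ ∀ i, f i ≤ k + i := by
  induction n generalizing k with
  | zero => simp [Bounded]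
  | succ n ih =>
    rw [List.ofFn_succ, Bounded, ih, Fin.forall_fin_succ]
    simp only [Fin.val_zero, Fin.val_succ, add_zero, add_assoc, add_comm 1]

theorem diagCount_ofFn {n : ℕ} (k : ℕ) (f : Fin n → ℕ) :
    diagCount k (List.ofFn f) = (Finset.univ.filter fun i => f i = k + i).card := by
  induction n generalizing k with
  | zero => simp [diagCount]
  | succ n ih =>
    rw [List.ofFn_succ, diagCount, ih, Fin.card_filter_univ_succ]
    simp only [Fin.val_zero, Fin.val_succ, add_zero]
    have : ∀ i : Fin n, k + 1 + (i : ℕ) = k + (i + 1) := fun i => by omega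
    simp only [this]
    split_ifs <;> omega

theorem ncard_eq_card_tables (n d : ℕ) :
    {a : Fin n → ℕ | (∀ i, a i ≤ i.1) ∧ (¬ ∃ p q : Fin n, p < q ∧ a p = a q + 1) ∧
      (Finset.univ.filter (fun i : Fin n => a i = i.1)).card = d}.ncard =
      ((tables n).filter fun g => 0 ∉ g ∧ diagCount 1 g = d).card := by
  rw [← Set.ncard_coe_finset]
  refine Set.ncard_congr (fun a _ => List.ofFn fun i => a i + 1) ?_ ?_ ?_
  · rintro a ⟨h1, h2, h3⟩
    simp only [Finset.coe_filter, Set.mem_ofPred_eq, mem_tables, List.length_ofFn, bounded_ofFn,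
      Admissible, List.pairwise_ofFn, diagCount_ofFn, List.mem_ofFn, true_and]
    refine ⟨⟨fun i => by have := h1 i; omega, fun i j hij => Or.inr fun h => ?_⟩, ?_, ?_⟩
    · exact h2 ⟨i, j, hij, by omega⟩
    · rintro ⟨i, hi⟩; simp at hi
    · rw [← h3]; congr 1; ext i; simp; omega
  · intro a b _ _ h
    ext i
    have := congrFun (List.ofFn_injective h) i
    simpa using this
  · intro g hg
    simp only [Finset.coe_filter, Set.mem_ofPred_eq, mem_tables] at hg
    obtain ⟨⟨rfl, h1, h2⟩, h3, h4⟩ := hg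
    have hpos : ∀ i : Fin g.length, g.get i - 1 + 1 = g.get i := fun i =>
      Nat.succ_pred_eq_of_ne_zero fun h => h3 (h ▸ List.get_mem g i)
    rw [← List.ofFn_get g, bounded_ofFn] at h1
    rw [← List.ofFn_get g, Admissible, List.pairwise_ofFn] at h2
    rw [← List.ofFn_get g, diagCount_ofFn] at h4
    refine ⟨fun i => g.get i - 1, ⟨fun i => ?_, ?_, ?_⟩, ?_⟩
    · exact Nat.sub_le_iff_le_add'.2 (h1 i)
    · rintro ⟨p, q, hpq, h⟩
      have := h2 hpq
      have := hpos p
      have := hpos q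
      simp only at h
      omega
    · rw [← h4]
      congr 1
      ext i
      have := hpos i
      simp only [Finset.mem_filter, Finset.mem_univ, true_and]
      omega
    · simp only [hpos, List.ofFn_get]

end Words

section Coefficients

open Polynomial

theorem tableSeries_zero_zero_eq {R : Type*} [CommRing R] (x t : R) (N : ℕ) :
    tableSeries x N t 0 0 =
      ∑ m ∈ Finset.range N, x ^ m * ∑ g ∈ tables m with 0 ∉ g, t ^ diagCount 1 g := by
  simp only [tableSeries, tableSum, weight_zero_zero, Finset.sum_filter]
  simp

theorem coeff_coeff_tableSeries (n d : ℕ) :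
    ((tableSeries (X : ℤ[X][X]) (n + 1) (C X) 0 0).coeff n).coeff d =
      ((tables n).filter fun g => 0 ∉ g ∧ diagCount 1 g = d).card := by
  rw [tableSeries_zero_zero_eq]
  simp only [← C_pow, ← map_sum, finsetSum_coeff, coeff_X_pow_mul', coeff_C]
  rw [Finset.sum_eq_single n]
  · simp only [le_refl, if_true, Nat.sub_self, finsetSum_coeff, coeff_X_pow, Finset.sum_boole,
      Finset.filter_filter, eq_comm (a := d)]
  · intro m hm hne
    have := Finset.mem_range.1 hm
    rw [if_pos (by omega), if_neg (by omega), coeff_zero]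
  · simp

theorem coeff_coeff_prod (n d k : ℕ) (hk : k ≤ n) :
    ((∏ i ∈ Finset.range k, (1 - (1 - C X * X) * (1 - X) ^ i) : ℤ[X][X]).coeff n).coeff d =
      ∑ _A ∈ (fishburnDiagrams k).filter (fun A => dots A = n ∧ dstat A = d),
        (-1 : ℤ) ^ (n - k) := by
  rw [prod_eq_sum_fishburnDiagrams, Finset.sum_filter, finsetSum_coeff, finsetSum_coeff]
  refine Finset.sum_congr rfl fun A _ => ?_
  have h : ((-1) ^ (k + dots A) * (X ^ dots A * C X ^ dstat A) : ℤ[X][X]) =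
      monomial (dots A) (monomial (dstat A) ((-1) ^ (k + dots A))) := by
    rw [← C_mul_X_pow_eq_monomial, ← C_mul_X_pow_eq_monomial]
    simp only [map_mul, map_pow, map_neg, map_one]
    ring
  rw [h, coeff_monomial]
  by_cases h1 : dots A = n
  · rw [if_pos h1, coeff_monomial]
    by_cases h2 : dstat A = d
    · rw [if_pos h2, if_pos ⟨h1, h2⟩, h1]
      obtain ⟨j, rfl⟩ := Nat.exists_eq_add_of_le hk
      rw [Nat.add_sub_cancel_left, ← add_assoc, pow_add, Even.neg_one_pow ⟨k, rfl⟩, one_mul]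
    · rw [if_neg h2, if_neg fun h => h2 h.2]
  · rw [if_neg h1, if_neg fun h => h1 h.1, coeff_zero]

theorem pow_dvd_tableSeries_sub_sum_prod {S : Type*} [CommRing S] (x t : S) (N : ℕ) :
    x ^ N ∣ tableSeries x N t 0 0 -
      ∑ k ∈ Finset.range N, ∏ i ∈ Finset.range k, (1 - (1 - t * x) * (1 - x) ^ i) := by
  have hx : Ideal.Quotient.mk (Ideal.span {x ^ N}) x ^ N = 0 := by
    rw [← map_pow]
    exact Ideal.Quotient.eq_zero_iff_mem.2 (Ideal.mem_span_singleton_self _)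
  have h := tableSeries_eq_sum_prod hx (Ideal.Quotient.mk _ t)
  rw [tableSeries_zero_zero_eq] at h ⊢
  rw [← Ideal.mem_span_singleton, ← Ideal.Quotient.eq]
  simpa only [map_sum, map_mul, map_pow, map_prod, map_sub, map_one] using h

theorem coeff_tableSeries (n : ℕ) :
    (tableSeries (X : ℤ[X][X]) (n + 1) (C X) 0 0).coeff n =
      (∑ k ∈ Finset.range (n + 1),
        ∏ i ∈ Finset.range k, (1 - (1 - C X * X) * (1 - X) ^ i) : ℤ[X][X]).coeff n := by
  have h := X_pow_dvd_iff.1 (pow_dvd_tableSeries_sub_sum_prod (X : ℤ[X][X]) (C X) (n + 1))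
  exact sub_eq_zero.1 ((coeff_sub _ _ _).symm.trans (h n n.lt_succ_self))

end Coefficients

end FishburnDiagram

/-- For `n ≥ 1` and `1 ≤ d ≤ n`, `Σ_{A ∈ Y_{n,d}} (-1)^{n-k} = |T_{n,d}|`, the sum over
all Fishburn diagrams with exactly `n` dots and `d(A) = d` (`k` the number of columns;
a diagram with `k` columns has at least `k` dots, so summing over `k ≤ n` loses
nothing).  `T_{n,d}` consists of the inversion tables in `T_n` with `a_i = i - 1`
(0-based: `a i = i`) for exactly `d` values of `i`. -/
theorem fishburn_diagram_refined_signed_sum_eq_Tnd (n d : ℕ)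
    (hn : 1 ≤ n) (hd : 1 ≤ d) (hdn : d ≤ n) :
    (∑ k ∈ Finset.range (n + 1),
        ∑ A ∈ (fishburnDiagrams k).filter (fun A => dots A = n ∧ dstat A = d),
          ((-1 : ℤ)) ^ (n - k)) =
      ({a : Fin n → ℕ | (∀ i, a i ≤ i.1) ∧
        (¬ ∃ p q : Fin n, p < q ∧ a p = a q + 1) ∧
        (Finset.univ.filter (fun i : Fin n => a i = i.1)).card = d}.ncard : ℤ) := by
  rw [FishburnDiagram.ncard_eq_card_tables, ← FishburnDiagram.coeff_coeff_tableSeries,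
    FishburnDiagram.coeff_tableSeries, Polynomial.finsetSum_coeff, Polynomial.finsetSum_coeff]
  exact Finset.sum_congr rfl fun k hk =>
    (FishburnDiagram.coeff_coeff_prod n d k (Finset.mem_range_succ_iff.1 hk)).symm
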